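/- In every Pr_Ł²Δ model, the following semantic equalities hold for all L_BD formulas φ and all L_PrŁ²Δ formulas α, α': e(¬Pr φ) = e(Pr ¬φ); e(¬¬α) = e(α); e(¬∼α) = e(∼¬α); e(¬(α→α')) = e(∼(¬α'→¬α)); e(¬Δα) = e(∼Δ∼¬α), where e(β) denotes the pair (e₁(β), e₂(β)). Consequently each rewrite step of the ¬-normal-form transformation preserves the semantic value, and e(α) = e(α^¬) for the resulting normal form α^¬. -/

import Mathlib

inductive BD : Type where
  | var : ℕ → BD
  | neg : BD → BD
  | and : BD → BD → BD
  | or  : BD → BD → BD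

structure BDModel (W : Type) where
  vpos : ℕ → Set W
  vneg : ℕ → Set W

mutual
  def suppT {W : Type} (M : BDModel W) : BD → W → Prop
    | .var p, w => w ∈ M.vpos p
    | .neg φ, w => suppF M φ w
    | .and φ χ, w => suppT M φ w ∧ suppT M χ w
    | .or φ χ, w => suppT M φ w ∨ suppT M χ w
  def suppF {W : Type} (M : BDModel W) : BD → W → Prop
    | .var p, w => w ∈ M.vneg p
    | .neg φ, w => suppT M φ w
    | .and φ χ, w => suppF M φ w ∨ suppF M χ w
    | .or φ χ, w => suppF M φ w ∧ suppF M χ w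
end

def extP {W : Type} (M : BDModel W) (φ : BD) : Set W := {w | suppT M φ w}
def extN {W : Type} (M : BDModel W) (φ : BD) : Set W := {w | suppF M φ w}

/-- A BD model (on a nonempty carrier) together with a ±-probability. -/
structure PrModel (W : Type) [Nonempty W] where
  M : BDModel W
  mu : Set W → ℝ
  mu_mem : ∀ X : Set W, mu X ∈ Set.Icc (0:ℝ) 1
  mon : ∀ X Y : Set W, X ⊆ Y → mu X ≤ mu Y
  negp : ∀ φ : BD, mu (extN M φ) = mu (extP M (.neg φ))
  ex : ∀ φ χ : BD,
    mu (extP M (.or φ χ)) = mu (extP M φ) + mu (extP M χ) - mu (extP M (.and φ χ))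

/-- The language L_PrŁ²Δ: α ::= Pr φ | ¬α | ∼α | Δα | (α→α). -/
inductive PrF : Type where
  | pr : BD → PrF
  | neg : PrF → PrF
  | snot : PrF → PrF
  | delta : PrF → PrF
  | imp : PrF → PrF → PrF

open Classical in
mutual
  /-- Support of truth e₁ in a Pr_Ł²Δ model. -/
  noncomputable def pe1 {W : Type} [Nonempty W] (P : PrModel W) : PrF → ℝ
    | .pr φ => P.mu (extP P.M φ)
    | .neg α => pe2 P α
    | .snot α => 1 - pe1 P α
    | .delta α => if pe1 P α = 1 then 1 else 0
    | .imp α β => min 1 (1 - pe1 P α + pe1 P β)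
  /-- Support of falsity e₂ in a Pr_Ł²Δ model. -/
  noncomputable def pe2 {W : Type} [Nonempty W] (P : PrModel W) : PrF → ℝ
    | .pr φ => P.mu (extN P.M φ)
    | .neg α => pe1 P α
    | .snot α => 1 - pe2 P α
    | .delta α => if pe2 P α = 0 then 0 else 1
    | .imp α β => max 0 (pe2 P β - pe2 P α)
end

/-- Pr_Ł²Δ validity: value (1,0) in every model. -/
def PrValid (α : PrF) : Prop :=
  ∀ (W : Type) (_ : Nonempty W) (P : PrModel W), pe1 P α = 1 ∧ pe2 P α = 0

/-- The ¬-normal form transformation pushing ¬ to modal atoms. -/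
def PrF.nnf : PrF → PrF
  | .pr φ => .pr φ
  | .snot α => .snot α.nnf
  | .delta α => .delta α.nnf
  | .imp α β => .imp α.nnf β.nnf
  | .neg (.pr φ) => .pr (.neg φ)
  | .neg (.neg α) => α.nnf
  | .neg (.snot α) => .snot (PrF.nnf (.neg α))
  | .neg (.imp α β) => .snot (.imp (PrF.nnf (.neg β)) (PrF.nnf (.neg α)))
  | .neg (.delta α) => .snot (.delta (.snot (PrF.nnf (.neg α))))

section RewriteRules

variable {W : Type} [Nonempty W] (P : PrModel W)

theorem sem_neg_pr (φ : BD) :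
    (pe1 P (.neg (.pr φ)), pe2 P (.neg (.pr φ))) =
      (pe1 P (.pr (.neg φ)), pe2 P (.pr (.neg φ))) := by
  simp [pe1, pe2, extP, extN, suppT, suppF]

theorem sem_neg_neg (α : PrF) :
    (pe1 P (.neg (.neg α)), pe2 P (.neg (.neg α))) = (pe1 P α, pe2 P α) := by
  simp only [pe1, pe2]

theorem sem_neg_snot (α : PrF) :
    (pe1 P (.neg (.snot α)), pe2 P (.neg (.snot α))) =
      (pe1 P (.snot (.neg α)), pe2 P (.snot (.neg α))) := by
  simp only [pe1, pe2]

theorem sem_neg_imp (α α' : PrF) :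
    (pe1 P (.neg (.imp α α')), pe2 P (.neg (.imp α α'))) =
      (pe1 P (.snot (.imp (.neg α') (.neg α))), pe2 P (.snot (.imp (.neg α') (.neg α)))) := by
  simp only [pe1, pe2, Prod.mk.injEq]
  grind

theorem sem_neg_delta (α : PrF) :
    (pe1 P (.neg (.delta α)), pe2 P (.neg (.delta α))) =
      (pe1 P (.snot (.delta (.snot (.neg α)))), pe2 P (.snot (.delta (.snot (.neg α))))) := by
  simp only [pe1, pe2, Prod.mk.injEq]
  grind

theorem sem_nnf_and_nnf_neg (β : PrF) :
    (pe1 P β.nnf, pe2 P β.nnf) = (pe1 P β, pe2 P β) ∧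
    (pe1 P (PrF.neg β).nnf, pe2 P (PrF.neg β).nnf) = (pe1 P (.neg β), pe2 P (.neg β)) := by
  induction β with
  | pr φ => exact ⟨by rw [PrF.nnf], by rw [sem_neg_pr, PrF.nnf]⟩
  | neg α ih => exact ⟨ih.2, by rw [sem_neg_neg, PrF.nnf, ih.1]⟩
  | snot α ih =>
    rw [sem_neg_snot]
    simp_all [PrF.nnf, pe1, pe2]
  | delta α ih =>
    rw [sem_neg_delta]
    simp only [PrF.nnf, pe1, pe2, Prod.mk.injEq] at ih ⊢
    grind
  | imp α α' ih ih' =>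
    rw [sem_neg_imp]
    simp_all [PrF.nnf, pe1, pe2]

end RewriteRules

/-- Each ¬-rewrite step preserves the pair (e₁, e₂), and consequently
the ¬-normal form α^¬ has the same semantic value as α in every Pr_Ł²Δ model. -/
theorem nnf_semantics_preserved {W : Type} [Nonempty W] (P : PrModel W)
    (φ : BD) (α α' : PrF) :
    (pe1 P (.neg (.pr φ)), pe2 P (.neg (.pr φ))) = (pe1 P (.pr (.neg φ)), pe2 P (.pr (.neg φ))) ∧
    (pe1 P (.neg (.neg α)), pe2 P (.neg (.neg α))) = (pe1 P α, pe2 P α) ∧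
    (pe1 P (.neg (.snot α)), pe2 P (.neg (.snot α))) =
      (pe1 P (.snot (.neg α)), pe2 P (.snot (.neg α))) ∧
    (pe1 P (.neg (.imp α α')), pe2 P (.neg (.imp α α'))) =
      (pe1 P (.snot (.imp (.neg α') (.neg α))), pe2 P (.snot (.imp (.neg α') (.neg α)))) ∧
    (pe1 P (.neg (.delta α)), pe2 P (.neg (.delta α))) =
      (pe1 P (.snot (.delta (.snot (.neg α)))), pe2 P (.snot (.delta (.snot (.neg α))))) ∧
    (∀ β : PrF, (pe1 P β.nnf, pe2 P β.nnf) = (pe1 P β, pe2 P β)) := by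
  exact ⟨sem_neg_pr P φ, sem_neg_neg P α, sem_neg_snot P α, sem_neg_imp P α α',
    sem_neg_delta P α, fun β => (sem_nnf_and_nnf_neg P β).1⟩
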